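/- arXiv:cs/0101026 — 2 statements merged into one kernel-verified Lean document; each statement's English description precedes it below -/
import Mathlib

section
/- Let (C, S, N, f) be an automaton with f local. If f is locally commutative then f is commutative. -/
namespace AsyncUpdating

variable {C S : Type*}

/-- `f` is a transition function for the neighborhood function `N`:
`f ξ x` depends only on the restriction of `ξ` to `N x`. -/
def IsTransition (N : C → Set C) (f : (C → S) → C → S) : Prop :=
  ∀ (ξ₁ ξ₂ : C → S) (x : C), (∀ y ∈ N x, ξ₁ y = ξ₂ y) → f ξ₁ x = f ξ₂ x

/-- The automaton is local: every neighborhood is finite. -/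
def IsLocal (N : C → Set C) : Prop := ∀ x, (N x).Finite

open Classical in
/-- `upd f ξ E` is the configuration `f(ξ, E)`: apply `f` at the sites of `E` only. -/
noncomputable def upd (f : (C → S) → C → S) (ξ : C → S) (E : Set C) : C → S :=
  fun x => if x ∈ E then f ξ x else ξ x

/-- The set `L(ξ)` of free sites. -/
def freeSet (f : (C → S) → C → S) (ξ : C → S) : Set C := {x | f ξ x ≠ ξ x}

/-- `η` is an asynchronous trajectory of `f`. -/
def IsAsyncTraj (f : (C → S) → C → S) (η : C → ℕ → S) : Prop :=
  ∀ x t, η x (t + 1) ≠ η x t → η x (t + 1) = f (fun y => η y t) x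

/-- `η` is a synchronous trajectory of `f`. -/
def IsSyncTraj (f : (C → S) → C → S) (η : C → ℕ → S) : Prop :=
  ∀ x t, η x (t + 1) = f (fun y => η y t) x

/-- The synchronous trajectory of `f` with initial configuration `ξ`. -/
def syncTraj (f : (C → S) → C → S) (ξ : C → S) : ℕ → C → S
  | 0 => ξ
  | t + 1 => f (syncTraj f ξ t)

/-- The update set `U(t, η)`. -/
def updSet (η : C → ℕ → S) (t : ℕ) : Set C := {x | η x (t + 1) ≠ η x t}

open Classical in
/-- The effective age `τ(x, t, η)`: the number of `s < t` with `x ∈ U(s, η)`. -/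
noncomputable def effAge (η : C → ℕ → S) (x : C) (t : ℕ) : ℕ :=
  ((Finset.range t).filter fun s => η x (s + 1) ≠ η x s).card

/-- `f` has invariant histories. -/
def InvariantHistories (f : (C → S) → C → S) : Prop :=
  ∀ ξ : C → S, ∃ ζ : C → ℕ → S, ∀ η : C → ℕ → S,
    IsAsyncTraj f η → (∀ x, η x 0 = ξ x) → ∀ x t, η x t = ζ x (effAge η x t)

/-- `f` is monotonic: `L(t,η) \ U(t,η) ⊆ L(t+1,η)` for every asynchronous trajectory. -/
def Monotonic (f : (C → S) → C → S) : Prop :=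
  ∀ η : C → ℕ → S, IsAsyncTraj f η → ∀ t,
    freeSet f (fun x => η x t) \ updSet η t ⊆ freeSet f (fun x => η x (t + 1))

/-- `f` is commutative. -/
def CommutativeRule (f : (C → S) → C → S) : Prop :=
  ∀ (ξ : C → S) (A B : Set C), Disjoint A B →
    A ⊆ freeSet f ξ → B ⊆ freeSet f ξ →
    upd f (upd f ξ A) B = upd f ξ (A ∪ B)

/-- `f` is locally commutative. -/
def LocallyCommutative (f : (C → S) → C → S) : Prop :=
  ∀ (ξ : C → S) (x y : C), x ≠ y → x ∈ freeSet f ξ → y ∈ freeSet f ξ →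
    upd f (upd f ξ {x}) {y} = upd f ξ {x, y}

/-- `η₁` dominates `η₀` (they are assumed to have the same initial configuration). -/
def Dominates (η₁ η₀ : C → ℕ → S) : Prop :=
  (∀ x t, effAge η₀ x t ≤ effAge η₁ x t) ∧
  (∀ x t₀ t₁, effAge η₀ x t₀ = effAge η₁ x t₁ → η₀ x t₀ = η₁ x t₁)

theorem upd_of_mem {C S : Type*} (f : (C → S) → C → S) (ξ : C → S) {E : Set C} {x : C}
    (hx : x ∈ E) : upd f ξ E x = f ξ x :=
  if_pos hx

theorem upd_of_notMem {C S : Type*} (f : (C → S) → C → S) (ξ : C → S) {E : Set C} {x : C}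
    (hx : x ∉ E) : upd f ξ E x = ξ x :=
  if_neg hx

/-- Updating a finite set of free sites does not change the transition value at another
free site. -/
theorem LocallyCommutative.apply_upd_of_finite {C S : Type*} {f : (C → S) → C → S}
    (hlc : LocallyCommutative f) {ξ : C → S} {F : Set C} (hF : F.Finite)
    (hFξ : F ⊆ freeSet f ξ) {y : C} (hy : y ∈ freeSet f ξ) (hyF : y ∉ F) :
    f (upd f ξ F) y = f ξ y := by
  induction F, hF using Set.Finite.induction_on generalizing y with
  | empty =>
    have h : upd f ξ ∅ = ξ := by
      funext x
      exact upd_of_notMem f ξ (Set.notMem_empty x)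
    rw [h]
  | @insert a F haF _ ih =>
    rw [Set.insert_subset_iff] at hFξ
    rw [Set.mem_insert_iff, not_or] at hyF
    have hfa := ih hFξ.2 hFξ.1 haF
    have hfy := ih hFξ.2 hy hyF.2
    have hupd : upd f ξ (insert a F) = upd f (upd f ξ F) {a} := by
      funext x
      by_cases hx : x = a
      · subst hx
        rw [upd_of_mem f ξ (Set.mem_insert x F), upd_of_mem f _ (Set.mem_singleton x), hfa]
      · rw [upd_of_notMem f (upd f ξ F) (E := {a}) hx]
        by_cases hxF : x ∈ F
        · rw [upd_of_mem f ξ hxF, upd_of_mem f ξ (Set.mem_insert_of_mem a hxF)]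
        · rw [upd_of_notMem f ξ hxF, upd_of_notMem f ξ (by simp [hx, hxF])]
    have ha' : a ∈ freeSet f (upd f ξ F) := by
      have h : upd f ξ F a = ξ a := upd_of_notMem f ξ haF
      simpa [freeSet, hfa, h] using hFξ.1
    have hy' : y ∈ freeSet f (upd f ξ F) := by
      have h : upd f ξ F y = ξ y := upd_of_notMem f ξ hyF.2
      simpa [freeSet, hfy, h] using hy
    have hcomm : f (upd f (upd f ξ F) {a}) y = f (upd f ξ F) y := by
      have h := congrFun (hlc (upd f ξ F) a y (Ne.symm hyF.1) ha' hy') y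
      rwa [upd_of_mem f _ (Set.mem_singleton y), upd_of_mem f _ (by simp)] at h
    rw [hupd, hcomm, hfy]

/-- Let (C, S, N, f) be an automaton with f local. If f is locally
commutative then f is commutative. -/
theorem commutative_of_locallyCommutative
    {C S : Type*} (N : C → Set C) (f : (C → S) → C → S)
    (hf : IsTransition N f) (hloc : IsLocal N)
    (hlc : LocallyCommutative f) :
    CommutativeRule f := by
  intro ξ A B hAB hA hB
  funext y
  by_cases hy : y ∈ B
  · have hyA : y ∉ A := fun h => hAB.notMem_of_mem_left h hy
    have hrestrict : f (upd f ξ A) y = f (upd f ξ (A ∩ N y)) y := by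
      refine hf _ _ y fun z hz => ?_
      by_cases hzA : z ∈ A
      · rw [upd_of_mem f ξ hzA, upd_of_mem f ξ (Set.mem_inter hzA hz)]
      · rw [upd_of_notMem f ξ hzA, upd_of_notMem f ξ fun h => hzA h.1]
    have hvalue : f (upd f ξ A) y = f ξ y :=
      hrestrict.trans <| hlc.apply_upd_of_finite ((hloc y).inter_of_right A)
        (Set.inter_subset_left.trans hA) (hB hy) fun h => hyA h.1
    rw [upd_of_mem f _ hy, upd_of_mem f ξ (Or.inr hy), hvalue]
  · rw [upd_of_notMem f _ hy]
    by_cases hyA : y ∈ A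
    · rw [upd_of_mem f ξ hyA, upd_of_mem f ξ (Or.inl hyA)]
    · rw [upd_of_notMem f ξ hyA, upd_of_notMem f ξ fun h => h.elim hyA hy]

end AsyncUpdating
end

section
/- Let (C, S, N, f) be an automaton. If f is commutative then f has invariant histories. -/
namespace AsyncUpdating

variable {C S : Type*}

section Helpers

variable {f : (C → S) → C → S} {ξ : C → S} {η : C → ℕ → S}

theorem effAge_zero (η : C → ℕ → S) (x : C) : effAge η x 0 = 0 := by
  simp [effAge]

open Classical in
theorem effAge_succ (η : C → ℕ → S) (x : C) (t : ℕ) :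
    effAge η x (t + 1) = effAge η x t + if x ∈ updSet η t then 1 else 0 := by
  unfold effAge
  rw [Finset.range_add_one, Finset.filter_insert]
  by_cases h : η x (t + 1) = η x t <;> simp [updSet, h]

open Classical in
theorem effAge_succ' (η : C → ℕ → S) (x : C) (t : ℕ) :
    effAge η x (t + 1) =
      effAge (fun y s => η y (s + 1)) x t + if x ∈ updSet η 0 then 1 else 0 := by
  induction t with
  | zero => simp [effAge_succ, effAge_zero]
  | succ t ih =>
    rw [effAge_succ, ih, effAge_succ _ _ t, add_right_comm]
    rfl

theorem eq_initial_of_effAge_eq_zero (η : C → ℕ → S) (x : C) (t : ℕ)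
    (h : effAge η x t = 0) : η x t = η x 0 := by
  induction t with
  | zero => rfl
  | succ t ih =>
    rw [effAge_succ] at h
    have h' : η x (t + 1) = η x t := by
      by_contra hne
      simp [updSet, hne] at h
    rw [h', ih (by omega)]

theorem IsAsyncTraj.updSet_subset (hη : IsAsyncTraj f η) (t : ℕ) :
    updSet η t ⊆ freeSet f fun y => η y t := by
  intro x hx
  change f (fun y => η y t) x ≠ η x t
  exact hη x t hx ▸ hx

theorem IsAsyncTraj.succ_eq_upd (hη : IsAsyncTraj f η) (t : ℕ) :
    (fun y => η y (t + 1)) = upd f (fun y => η y t) (updSet η t) := by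
  funext x
  by_cases h : x ∈ updSet η t
  · rw [upd, if_pos h]
    exact hη x t h
  · rw [upd, if_neg h]
    exact not_not.mp h

theorem CommutativeRule.subset_freeSet_upd (hc : CommutativeRule f) {A B : Set C}
    (hAB : Disjoint A B) (hA : A ⊆ freeSet f ξ) (hB : B ⊆ freeSet f ξ) :
    B ⊆ freeSet f (upd f ξ A) := by
  intro x hx
  have hxA : x ∉ A := fun h => hAB.le_bot ⟨h, hx⟩
  have h : f (upd f ξ A) x = f ξ x := by
    simpa [upd, hx] using congrFun (hc ξ A B hAB hA hB) x
  have hxL : f ξ x ≠ ξ x := hB hx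
  change f (upd f ξ A) x ≠ upd f ξ A x
  rwa [h, upd, if_neg hxA]

/-- Updating at `A` and then at the rest of `B` agrees with updating at `B` and then at the
rest of `A`. -/
theorem CommutativeRule.upd_diff_comm (hc : CommutativeRule f) {A B : Set C}
    (hA : A ⊆ freeSet f ξ) (hB : B ⊆ freeSet f ξ) :
    upd f (upd f ξ A) (B \ A) = upd f (upd f ξ B) (A \ B) := by
  rw [hc ξ A (B \ A) Set.disjoint_sdiff_right hA (Set.sdiff_subset.trans hB),
    hc ξ B (A \ B) Set.disjoint_sdiff_right hB (Set.sdiff_subset.trans hA),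
    Set.union_sdiff_self, Set.union_sdiff_self, Set.union_comm]

/-- The sites of `B` at which `η` has not been updated before time `t`. -/
def pending (η : C → ℕ → S) (B : Set C) (t : ℕ) : Set C := {x ∈ B | effAge η x t = 0}

theorem pending_zero (η : C → ℕ → S) (B : Set C) : pending η B 0 = B := by
  simp [pending, effAge_zero]

theorem pending_succ (η : C → ℕ → S) (B : Set C) (t : ℕ) :
    pending η B (t + 1) = pending η B t \ updSet η t := by
  ext x
  by_cases h : x ∈ updSet η t <;> simp +contextual [pending, effAge_succ, h]

/-- The trajectory `η` with the sites of `B` updated in advance at time `0`. -/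
noncomputable def advance (f : (C → S) → C → S) (η : C → ℕ → S) (B : Set C) : C → ℕ → S :=
  fun x t => upd f (fun y => η y t) (pending η B t) x

theorem pending_subset_freeSet (hc : CommutativeRule f) (hη : IsAsyncTraj f η) {B : Set C}
    (hB : B ⊆ freeSet f fun y => η y 0) (t : ℕ) :
    pending η B t ⊆ freeSet f fun y => η y t := by
  induction t with
  | zero => rwa [pending_zero]
  | succ t ih =>
    rw [pending_succ, hη.succ_eq_upd t]
    exact hc.subset_freeSet_upd Set.disjoint_sdiff_right (hη.updSet_subset t)
      (Set.sdiff_subset.trans ih)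

theorem advance_succ (hc : CommutativeRule f) (hη : IsAsyncTraj f η) {B : Set C}
    (hB : B ⊆ freeSet f fun y => η y 0) (t : ℕ) :
    (fun y => advance f η B y (t + 1)) =
      upd f (fun y => advance f η B y t) (updSet η t \ pending η B t) := by
  change upd f (fun y => η y (t + 1)) (pending η B (t + 1)) =
    upd f (upd f (fun y => η y t) (pending η B t)) (updSet η t \ pending η B t)
  rw [pending_succ, hη.succ_eq_upd t]
  exact hc.upd_diff_comm (hη.updSet_subset t) (pending_subset_freeSet hc hη hB t)

theorem isAsyncTraj_advance (hc : CommutativeRule f) (hη : IsAsyncTraj f η) {B : Set C}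
    (hB : B ⊆ freeSet f fun y => η y 0) : IsAsyncTraj f (advance f η B) := by
  intro x t hne
  have h := congrFun (advance_succ hc hη hB t) x
  by_cases hx : x ∈ updSet η t \ pending η B t
  · rwa [upd, if_pos hx] at h
  · rw [upd, if_neg hx] at h
    exact absurd h hne

theorem updSet_advance (hc : CommutativeRule f) (hη : IsAsyncTraj f η) {B : Set C}
    (hB : B ⊆ freeSet f fun y => η y 0) (t : ℕ) :
    updSet (advance f η B) t = updSet η t \ pending η B t := by
  ext x
  have h := congrFun (advance_succ hc hη hB t) x
  by_cases hx : x ∈ updSet η t \ pending η B t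
  · have hfree := hc.subset_freeSet_upd Set.disjoint_sdiff_right
      (pending_subset_freeSet hc hη hB t) (Set.sdiff_subset.trans (hη.updSet_subset t)) hx
    rw [upd, if_pos hx] at h
    refine iff_of_true ?_ hx
    change advance f η B x (t + 1) ≠ advance f η B x t
    exact h.trans_ne hfree
  · rw [upd, if_neg hx] at h
    exact iff_of_false (fun hne => hne h) hx

open Classical in
theorem effAge_advance (hc : CommutativeRule f) (hη : IsAsyncTraj f η) {B : Set C}
    (hB : B ⊆ freeSet f fun y => η y 0) (x : C) (t : ℕ) :
    effAge (advance f η B) x t = effAge η x t - if x ∈ B then 1 else 0 := by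
  induction t with
  | zero => simp [effAge_zero]
  | succ t ih =>
    rw [effAge_succ, effAge_succ, ih, updSet_advance hc hη hB]
    simp only [pending, Set.mem_sdiff, Set.mem_ofPred_eq]
    split_ifs <;> grind

/-- Two asynchronous trajectories with the same initial configuration agree at a site whenever
the effective ages agree. -/
theorem CommutativeRule.eq_of_effAge_eq (hc : CommutativeRule f) {θ : C → ℕ → S}
    (hη : IsAsyncTraj f η) (hθ : IsAsyncTraj f θ) (h0 : ∀ x, η x 0 = θ x 0) (x : C) (s t : ℕ)
    (h : effAge η x s = effAge θ x t) : η x s = θ x t := by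
  induction t generalizing η θ with
  | zero =>
    rw [effAge_zero] at h
    rw [eq_initial_of_effAge_eq_zero η x s h, h0]
  | succ t ih =>
    have hcfg : (fun y => η y 0) = fun y => θ y 0 := funext h0
    have hB : updSet θ 0 ⊆ freeSet f fun y => η y 0 := hcfg ▸ hθ.updSet_subset 0
    have hx : x ∉ pending η (updSet θ 0) s := by
      rintro ⟨hxB, hx0⟩
      rw [hx0, effAge_succ', if_pos hxB] at h
      omega
    have key := ih (isAsyncTraj_advance hc hη hB) (θ := fun y r => θ y (r + 1))
      (fun y r => hθ y (r + 1))
      (fun y => by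
        rw [advance, pending_zero, hcfg]
        exact (congrFun (hθ.succ_eq_upd 0) y).symm)
      (by rw [effAge_advance hc hη hB, h, effAge_succ', Nat.add_sub_cancel])
    rwa [advance, upd, if_neg hx] at key

end Helpers

/-- Let (C, S, N, f) be an automaton. If f is commutative then f has
invariant histories. -/
theorem invariantHistories_of_commutative
    {C S : Type*} (N : C → Set C) (f : (C → S) → C → S)
    (hf : IsTransition N f) (hc : CommutativeRule f) :
    InvariantHistories f := by
  classical
  intro ξ
  refine ⟨fun x n => if h : ∃ (η : C → ℕ → S) (t : ℕ), IsAsyncTraj f η ∧ (∀ y, η y 0 = ξ y) ∧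
    effAge η x t = n then h.choose x h.choose_spec.choose else ξ x, fun η hη h0 x t => ?_⟩
  have h : ∃ (θ : C → ℕ → S) (s : ℕ), IsAsyncTraj f θ ∧ (∀ y, θ y 0 = ξ y) ∧
    effAge θ x s = effAge η x t := ⟨η, t, hη, h0, rfl⟩
  obtain ⟨hθ, hθ0, hage⟩ := h.choose_spec.choose_spec
  simp only [dif_pos h]
  exact hc.eq_of_effAge_eq hη hθ (fun y => (h0 y).trans (hθ0 y).symm) x _ _ hage.symm

end AsyncUpdating
end
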